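/- (Section 2: estimate for large-scale balls) For every A > 1 there is a constant C > 0, depending only on A, such that the following holds. Let Γ be a rectifiable Jordan arc in a real Hilbert space H with 1 ≤ ℓ(Γ) < 2 and ℓ(Γ) − crd(Γ) ≤ ε for some 0 < ε ≤ 1/2. Let Ĝ be a multiresolution family for Γ with inflation factor A, and let G_L be the set of pairs (n, x) with n ≥ n₀, x ∈ X_n, for which Γ ⊆ B(x, 4A·2^{-n}). Then Σ_{(n,x) ∈ G_L} β(B(x, A·2^{-n}))² · 2A·2^{-n} ≤ C·ε. -/

import Mathlib

open Metric MeasureTheory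
open scoped ENNReal

/-- The affine line through `p` with direction `v`. -/
def lineThrough {H : Type*} [NormedAddCommGroup H] [InnerProductSpace ℝ H]
    (p v : H) : Set H :=
  {y | ∃ t : ℝ, y = p + t • v}

/-- The Jones beta number of a set `Q` relative to the arc `Γ`. -/
noncomputable def jonesBeta {H : Type*} [NormedAddCommGroup H] [InnerProductSpace ℝ H]
    (Γ Q : Set H) : ℝ :=
  (2 / Metric.diam Q) *
    sInf {r : ℝ | ∃ p v : H, v ≠ 0 ∧
      r = sSup ((fun x => Metric.infDist x (lineThrough p v)) '' (Q ∩ Γ))}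

/-- `γ` is an arclength parameterization of a rectifiable Jordan arc of length `L`:
injective and 1-Lipschitz on `[0, L]`, with the length of `γ` restricted to any
subinterval `[s, t]` equal to `t - s`. -/
structure IsArclengthParam {H : Type*} [NormedAddCommGroup H] [InnerProductSpace ℝ H]
    (γ : ℝ → H) (L : ℝ) : Prop where
  len_nonneg : 0 ≤ L
  inj : Set.InjOn γ (Set.Icc 0 L)
  lip : LipschitzOnWith 1 γ (Set.Icc 0 L)
  arclen : ∀ s t : ℝ, 0 ≤ s → s ≤ t → t ≤ L →
    eVariationOn γ (Set.Icc s t) = ENNReal.ofReal (t - s)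

/-- `X` determines a multiresolution family for `Γ` with starting scale `n₀`:
a nested sequence of `2⁻ⁿ`-nets for `Γ`. -/
structure IsMultiresolution {H : Type*} [NormedAddCommGroup H] [InnerProductSpace ℝ H]
    (Γ : Set H) (n₀ : ℤ) (X : ℤ → Set H) : Prop where
  subset_arc : ∀ n, n₀ ≤ n → X n ⊆ Γ
  nested : ∀ n, n₀ ≤ n → X n ⊆ X (n + 1)
  separated : ∀ n, n₀ ≤ n → ∀ x ∈ X n, ∀ y ∈ X n, x ≠ y → (2:ℝ)^(-n) < dist x y
  covers : ∀ n, n₀ ≤ n → Γ ⊆ ⋃ x ∈ X n, Metric.ball x ((2:ℝ)^(-n))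

/-- The beta sum `Σ_{Q ∈ Ĝ} β(Q)² diam(Q)` of a multiresolution family with
inflation factor `A`, valued in `[0, ∞]`. -/
noncomputable def betaSum {H : Type*} [NormedAddCommGroup H] [InnerProductSpace ℝ H]
    (Γ : Set H) (A : ℝ) (n₀ : ℤ) (X : ℤ → Set H) : ℝ≥0∞ :=
  ∑' (n : {m : ℤ // n₀ ≤ m}), ∑' (x : X n.1),
    ENNReal.ofReal
      (jonesBeta Γ (Metric.ball (x : H) (A * (2:ℝ)^(-n.1))) ^ 2 * (2 * A * (2:ℝ)^(-n.1)))

section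

variable {H : Type*} [NormedAddCommGroup H] [InnerProductSpace ℝ H]

/-- A point whose distances to `p` and `q` add up to at most `L` lies within
`√(L² - dist q p ²) / 2` of the line through `p` and `q`. -/
theorem four_mul_sq_infDist_lineThrough_le {p q x : H} {L : ℝ} (hpq : p ≠ q)
    (hx : dist x p + dist x q ≤ L) :
    4 * infDist x (lineThrough p (q - p)) ^ 2 ≤ L ^ 2 - dist q p ^ 2 := by
  set v := q - p with hv
  have hv0 : v ≠ 0 := sub_ne_zero.2 hpq.symm
  set t := inner ℝ v (x - p) / ‖v‖ ^ 2 with ht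
  set w := x - p - t • v with hw
  have hvn : ‖v‖ ^ 2 ≠ 0 := by simpa using hv0
  have hvw : inner ℝ v w = 0 := by
    rw [hw, inner_sub_right, inner_smul_right, real_inner_self_eq_norm_sq, ht]
    field_simp
    ring
  have hdist : infDist x (lineThrough p v) ≤ ‖w‖ := by
    have h := infDist_le_dist_of_mem (x := x) (s := lineThrough p v)
      (y := p + t • v) ⟨t, rfl⟩
    rwa [dist_eq_norm, ← sub_sub] at h
  have hxp : dist x p = ‖t • v + w‖ := by
    rw [dist_eq_norm, hw]; congr 1; abel
  have hxq : dist x q = ‖(1 - t) • v + w‖ := by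
    have h1 : x - q = w - (1 - t) • v := by
      rw [hw, sub_smul, one_smul, hv]; abel
    rw [dist_eq_norm, h1, ← norm_neg, neg_sub, ← sq_eq_sq₀ (norm_nonneg _) (norm_nonneg _),
      norm_sub_sq_real, norm_add_sq_real, inner_smul_left, hvw]
    simp
  have htri : ‖v + (2 : ℝ) • w‖ ≤ L := by
    refine le_trans ?_ hx
    rw [hxp, hxq]
    refine le_of_eq_of_le (congrArg _ ?_) (norm_add_le (t • v + w) ((1 - t) • v + w))
    rw [sub_smul, one_smul, two_smul]; abel
  have hsq : ‖v + (2 : ℝ) • w‖ ^ 2 = ‖v‖ ^ 2 + 4 * ‖w‖ ^ 2 := by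
    rw [norm_add_sq_real, inner_smul_right, hvw, norm_smul]
    norm_num
    ring
  have hL : ‖v + (2 : ℝ) • w‖ ^ 2 ≤ L ^ 2 := by gcongr
  have hd : infDist x (lineThrough p v) ^ 2 ≤ ‖w‖ ^ 2 := by
    gcongr
    exact infDist_nonneg
  rw [dist_eq_norm]
  linarith

/-- If `Γ ∩ B(x, r)` lies within `h` of some line, then `β(B(x, r)) ≤ h / r`. -/
theorem jonesBeta_ball_le [Nontrivial H] {Γ : Set H} {x p v : H} {r h : ℝ} (hr : 0 < r)
    (hh : 0 ≤ h) (hv : v ≠ 0) (hΓ : ∀ y ∈ Γ, infDist y (lineThrough p v) ≤ h) :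
    jonesBeta Γ (ball x r) ≤ h / r := by
  have hdiam : diam (ball x r) = 2 * r := diam_ball_eq x hr.le
  have hinf : sInf {s : ℝ | ∃ p v : H, v ≠ 0 ∧
      s = sSup ((fun y => infDist y (lineThrough p v)) '' (ball x r ∩ Γ))} ≤ h := by
    refine csInf_le_of_le (b := sSup ((fun y => infDist y (lineThrough p v)) '' (ball x r ∩ Γ)))
      ?_ ⟨p, v, hv, rfl⟩ ?_
    · refine ⟨0, ?_⟩
      rintro _ ⟨p, v, -, rfl⟩
      refine Real.sSup_nonneg ?_
      rintro _ ⟨y, -, rfl⟩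
      exact infDist_nonneg
    · refine Real.sSup_le ?_ hh
      rintro _ ⟨y, hy, rfl⟩
      exact hΓ y hy.2
  calc jonesBeta Γ (ball x r) ≤ 2 / (2 * r) * h := by
        rw [jonesBeta, hdiam]
        gcongr
    _ = h / r := by field_simp

theorem jonesBeta_nonneg (Γ Q : Set H) : 0 ≤ jonesBeta Γ Q := by
  refine mul_nonneg (div_nonneg zero_le_two diam_nonneg) (Real.sInf_nonneg ?_)
  rintro _ ⟨p, v, -, rfl⟩
  refine Real.sSup_nonneg ?_
  rintro _ ⟨y, -, rfl⟩
  exact infDist_nonneg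

end

/-- The sum of a constant over a `δ⁻¹`-separated subset of a 1-Lipschitz image of `[0, L]`
is at most `1 + L * δ` times the constant. -/
theorem tsum_const_le_of_separated {M : Type*} [PseudoMetricSpace M] {γ : ℝ → M} {L δ : ℝ}
    (hL : 0 ≤ L) (hδ : 0 < δ) (hγ : LipschitzOnWith 1 γ (Set.Icc 0 L))
    {S : Set M} (hS : S ⊆ γ '' Set.Icc 0 L)
    (hsep : ∀ x ∈ S, ∀ y ∈ S, x ≠ y → δ⁻¹ < dist x y) (c : ℝ≥0∞) :
    ∑' _ : S, c ≤ ENNReal.ofReal (1 + L * δ) * c := by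
  choose s hs hsγ using fun x : S => hS x.2
  let φ : S → Fin (⌊L * δ⌋₊ + 1) := fun x =>
    ⟨⌊s x * δ⌋₊, Nat.lt_succ_of_le (Nat.floor_mono (by have := (hs x).2; gcongr))⟩
  have hφ : Function.Injective φ := by
    intro x y hxy
    by_contra hne
    have hfl : ⌊s x * δ⌋₊ = ⌊s y * δ⌋₊ := congrArg Fin.val hxy
    have hd := hsep x x.2 y y.2 (fun h => hne (Subtype.ext h))
    have hlip := hγ.dist_le_mul _ (hs x) _ (hs y)
    rw [hsγ, hsγ, NNReal.coe_one, one_mul, Real.dist_eq] at hlip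
    have hδs : 1 < |s x - s y| * δ := by
      rw [← inv_mul_cancel₀ hδ.ne']
      have := hd.trans_le hlip
      gcongr
    rw [← abs_of_pos hδ, ← abs_mul, sub_mul] at hδs
    have hx0 := (hs x).1
    have hy0 := (hs y).1
    have h1 := Nat.floor_le (show 0 ≤ s x * δ by positivity)
    have h2 := Nat.floor_le (show 0 ≤ s y * δ by positivity)
    have h3 := Nat.lt_floor_add_one (s x * δ)
    have h4 := Nat.lt_floor_add_one (s y * δ)
    rw [hfl] at h1 h3
    exact hδs.not_gt (abs_lt.2 ⟨by linarith, by linarith⟩)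
  refine (ENNReal.tsum_comp_le_tsum_of_injective hφ fun _ => c).trans ?_
  rw [tsum_fintype, Finset.sum_const, Finset.card_univ, Fintype.card_fin, nsmul_eq_mul,
    ← ENNReal.ofReal_natCast]
  gcongr
  push_cast
  linarith [Nat.floor_le (show 0 ≤ L * δ by positivity)]

/-- The powers of two that are at most `R` add up to at most `2 * R`. -/
theorem tsum_two_zpow_le {R : ℝ} (hR : 0 < R) :
    ∑' n : ℤ, (if (2 : ℝ) ^ n ≤ R then ENNReal.ofReal ((2 : ℝ) ^ n) else 0)
      ≤ ENNReal.ofReal (2 * R) := by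
  obtain ⟨N, hN, hN'⟩ := exists_mem_Ico_zpow (x := R) (y := (2 : ℝ)) hR one_lt_two
  have hinj : Function.Injective fun k : ℕ => N - (k : ℤ) := fun a b h => by
    simpa using h
  rw [← hinj.tsum_eq]
  · calc _ ≤ ∑' k : ℕ, ENNReal.ofReal (R * (1 / 2) ^ k) := by
          refine ENNReal.tsum_le_tsum fun k => ?_
          split_ifs
          · refine ENNReal.ofReal_le_ofReal ?_
            rw [zpow_sub₀ two_ne_zero, zpow_natCast, one_div, inv_pow, ← div_eq_mul_inv]
            gcongr
          · exact zero_le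
      _ = ENNReal.ofReal (2 * R) := by
          rw [← ENNReal.ofReal_tsum_of_nonneg (fun k => by positivity)
            (summable_geometric_two.mul_left R), tsum_mul_left, tsum_geometric_two, mul_comm]
  · intro n hn
    have hnR : (2 : ℝ) ^ n ≤ R := by
      by_contra h
      simp [h] at hn
    have hlt : n < N + 1 := (zpow_lt_zpow_iff_right₀ one_lt_two).1 (hnR.trans_lt hN')
    exact ⟨(N - n).toNat, by dsimp only; omega⟩

/-- Section 2, estimate for large-scale balls: for every `A > 1` there is `C > 0`
depending only on `A` such that if `Γ` is a rectifiable Jordan arc with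
`1 ≤ ℓ(Γ) < 2` and `ℓ(Γ) − crd(Γ) ≤ ε` for some `0 < ε ≤ 1/2`, and `Ĝ` is a
multiresolution family for `Γ` with inflation factor `A`, then the beta sum over the
pairs `(n, x)` with `Γ ⊆ B(x, 4A·2^{-n})` is at most `C·ε`. -/
theorem statement13 (A : ℝ) (hA : 1 < A) :
    ∃ C : ℝ, 0 < C ∧
      ∀ (H : Type) [NormedAddCommGroup H] [InnerProductSpace ℝ H] [CompleteSpace H]
        (γ : ℝ → H) (L : ℝ) (n₀ : ℤ) (X : ℤ → Set H) (ε : ℝ),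
        IsArclengthParam γ L →
        IsMultiresolution (γ '' Set.Icc 0 L) n₀ X →
        1 ≤ L → L < 2 → 0 < ε → ε ≤ 1/2 →
        L - dist (γ L) (γ 0) ≤ ε →
        (∑' (n : {m : ℤ // n₀ ≤ m}),
          ∑' (x : {x : H // x ∈ X n.1 ∧
              γ '' Set.Icc 0 L ⊆ Metric.ball x (4 * A * (2:ℝ)^(-n.1))}),
            ENNReal.ofReal
              (jonesBeta (γ '' Set.Icc 0 L) (Metric.ball (x : H) (A * (2:ℝ)^(-n.1))) ^ 2
                * (2 * A * (2:ℝ)^(-n.1))))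
          ≤ ENNReal.ofReal (C * ε) := by
  refine ⟨64 * (1 + 32 * A), by positivity, ?_⟩
  intro H _ _ _ γ L n₀ X ε hγ hX hL1 hL2 hε hε2 hcrd
  set Γ := γ '' Set.Icc 0 L with hΓ
  set c := dist (γ L) (γ 0) with hc
  have hA0 : 0 < A := one_pos.trans hA
  have h0mem : (0 : ℝ) ∈ Set.Icc 0 L := ⟨le_rfl, hγ.len_nonneg⟩
  have hLmem : L ∈ Set.Icc 0 L := ⟨hγ.len_nonneg, le_rfl⟩
  have hne : γ 0 ≠ γ L := by
    refine (dist_pos.1 ?_).symm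
    linarith
  have : Nontrivial H := ⟨⟨_, _, hne⟩⟩
  have hflat : ∀ y ∈ Γ, infDist y (lineThrough (γ 0) (γ L - γ 0)) ≤ √ε := by
    rintro _ ⟨s, hs, rfl⟩
    have h1 := hγ.lip.dist_le_mul s hs 0 h0mem
    have h2 := hγ.lip.dist_le_mul s hs L hLmem
    rw [NNReal.coe_one, one_mul, Real.dist_eq] at h1 h2
    rw [sub_zero, abs_of_nonneg hs.1] at h1
    rw [abs_of_nonpos (by linarith [hs.2])] at h2
    have h3 := four_mul_sq_infDist_lineThrough_le (L := L) hne
      (show dist (γ s) (γ 0) + dist (γ s) (γ L) ≤ L by linarith)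
    have hcL : c ≤ L := by
      have := hγ.lip.dist_le_mul L hLmem 0 h0mem
      rwa [NNReal.coe_one, one_mul, Real.dist_eq, sub_zero,
        abs_of_nonneg hγ.len_nonneg] at this
    refine Real.le_sqrt_of_sq_le ?_
    nlinarith
  have hterm : ∀ (n : ℤ) (x : H),
      jonesBeta Γ (ball x (A * (2:ℝ)^(-n))) ^ 2 * (2 * A * (2:ℝ)^(-n)) ≤
        2 / A * ε * (2:ℝ)^n := by
    intro n x
    have hβ := jonesBeta_ball_le (x := x) (r := A * (2:ℝ)^(-n)) (by positivity)
      (Real.sqrt_nonneg ε) (sub_ne_zero.2 hne.symm) hflat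
    have h0 := jonesBeta_nonneg Γ (ball x (A * (2:ℝ)^(-n)))
    calc _ ≤ (√ε / (A * (2:ℝ)^(-n))) ^ 2 * (2 * A * (2:ℝ)^(-n)) := by gcongr
      _ = _ := by
        rw [div_pow, Real.sq_sqrt hε.le, zpow_neg]
        field_simp
  have hscale : ∀ (n : ℤ) (x : H), Γ ⊆ ball x (4 * A * (2:ℝ)^(-n)) →
      (2:ℝ)^n ≤ 16 * A := by
    intro n x hx
    have h1 := mem_ball.1 (hx ⟨0, h0mem, rfl⟩)
    have h2 := mem_ball.1 (hx ⟨L, hLmem, rfl⟩)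
    have h3 := dist_triangle_right (γ L) (γ 0) x
    have h4 : 1 / 2 ≤ 8 * A * (2:ℝ)^(-n) := by linarith
    rw [zpow_neg, ← div_eq_mul_inv, le_div_iff₀ (by positivity)] at h4
    linarith
  have hinner : ∀ n : ℤ, n₀ ≤ n →
      (∑' x : {x : H // x ∈ X n ∧ Γ ⊆ ball x (4 * A * (2:ℝ)^(-n))},
        ENNReal.ofReal (jonesBeta Γ (ball (x : H) (A * (2:ℝ)^(-n))) ^ 2
          * (2 * A * (2:ℝ)^(-n)))) ≤
      ENNReal.ofReal ((1 + 32 * A) * (2 / A * ε)) *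
        (if (2:ℝ)^n ≤ 16 * A then ENNReal.ofReal ((2:ℝ)^n) else 0) := by
    intro n hn
    split_ifs with h
    · calc _ ≤ ∑' _ : {x : H | x ∈ X n ∧ Γ ⊆ ball x (4 * A * (2:ℝ)^(-n))},
            ENNReal.ofReal (2 / A * ε * (2:ℝ)^n) :=
          ENNReal.tsum_le_tsum fun x => ENNReal.ofReal_le_ofReal (hterm n x)
        _ ≤ ENNReal.ofReal (1 + L * (2:ℝ)^n) * ENNReal.ofReal (2 / A * ε * (2:ℝ)^n) := by
          refine tsum_const_le_of_separated hγ.len_nonneg (by positivity) hγ.lip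
            (fun x hx => hX.subset_arc n hn hx.1) (fun x hx y hy hxy => ?_) _
          rw [← zpow_neg]
          exact hX.separated n hn x hx.1 y hy.1 hxy
        _ ≤ _ := by
          have hL : L * (2:ℝ)^n ≤ 2 * (16 * A) := by gcongr
          rw [← ENNReal.ofReal_mul (by positivity), ← ENNReal.ofReal_mul (by positivity),
            mul_assoc (1 + 32 * A)]
          refine ENNReal.ofReal_le_ofReal ?_
          exact mul_le_mul_of_nonneg_right (by linarith) (by positivity)
    · rw [mul_zero, nonpos_iff_eq_zero, ENNReal.tsum_eq_zero]
      exact fun x => (h (hscale n x x.2.2)).elim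
  calc _ ≤ ∑' n : {m : ℤ // n₀ ≤ m}, ENNReal.ofReal ((1 + 32 * A) * (2 / A * ε)) *
          (if (2:ℝ)^n.1 ≤ 16 * A then ENNReal.ofReal ((2:ℝ)^n.1) else 0) :=
        ENNReal.tsum_le_tsum fun n => hinner n.1 n.2
    _ = ENNReal.ofReal ((1 + 32 * A) * (2 / A * ε)) * ∑' n : {m : ℤ // n₀ ≤ m},
          (if (2:ℝ)^n.1 ≤ 16 * A then ENNReal.ofReal ((2:ℝ)^n.1) else 0) :=
        ENNReal.tsum_mul_left
    _ ≤ ENNReal.ofReal ((1 + 32 * A) * (2 / A * ε)) * ENNReal.ofReal (2 * (16 * A)) := by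
        gcongr
        exact (ENNReal.tsum_comp_le_tsum_of_injective Subtype.val_injective _).trans
          (tsum_two_zpow_le (by positivity))
    _ = ENNReal.ofReal (64 * (1 + 32 * A) * ε) := by
        rw [← ENNReal.ofReal_mul (by positivity)]
        congr 1
        field_simp
        ring
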